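/- Let K be an n×n real symmetric positive definite matrix, f ∈ ℝⁿ, u* := K⁻¹f, and let j: ℝⁿ → ℝ be twice continuously differentiable. Let λ* ∈ ℝⁿ solve K λ* = ∇j(u*), let u_k ∈ ℝⁿ be arbitrary, define r(w) := K w − f and B := K⁻¹ [∫₀¹ ∇²j(θ u* + (1−θ) u_k) · θ dθ] K⁻¹. Then |j(u*) − j(u_k)| ≤ ‖λ*‖₂ ‖r(u_k)‖₂ + σ_max(B) ‖r(u_k)‖₂². -/

import Mathlib

open Matrix

/-- Euclidean (ℓ²) norm of a vector in `ℝⁿ`. -/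
noncomputable def l2norm {n : ℕ} (v : Fin n → ℝ) : ℝ :=
  ‖(WithLp.equiv 2 (Fin n → ℝ)).symm v‖

/-- Largest singular value of a (rectangular) matrix: the operator norm of the induced
linear map between Euclidean spaces. -/
noncomputable def sigmaMax {m n : ℕ} (A : Matrix (Fin m) (Fin n) ℝ) : ℝ :=
  ‖LinearMap.toContinuousLinearMap (Matrix.toEuclideanLin A)‖

open intervalIntegral

lemma abs_dotProduct_le_l2norm_mul_l2norm {n : ℕ} (x y : Fin n → ℝ) :
    |x ⬝ᵥ y| ≤ l2norm x * l2norm y := by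
  have h := abs_real_inner_le_norm (WithLp.toLp 2 y) (WithLp.toLp 2 x)
  rw [EuclideanSpace.inner_toLp_toLp, star_trivial, mul_comm] at h
  exact h

lemma l2norm_mulVec_le {m n : ℕ} (A : Matrix (Fin m) (Fin n) ℝ) (x : Fin n → ℝ) :
    l2norm (A *ᵥ x) ≤ sigmaMax A * l2norm x :=
  (LinearMap.toContinuousLinearMap (Matrix.toEuclideanLin A)).le_opNorm (WithLp.toLp 2 x)

lemma abs_dotProduct_mulVec_le {n : ℕ} (A : Matrix (Fin n) (Fin n) ℝ) (x : Fin n → ℝ) :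
    |x ⬝ᵥ A *ᵥ x| ≤ sigmaMax A * l2norm x ^ 2 := by
  have hx : 0 ≤ l2norm x := norm_nonneg _
  calc |x ⬝ᵥ A *ᵥ x| ≤ l2norm x * l2norm (A *ᵥ x) := abs_dotProduct_le_l2norm_mul_l2norm _ _
    _ ≤ l2norm x * (sigmaMax A * l2norm x) := by gcongr; exact l2norm_mulVec_le A x
    _ = sigmaMax A * l2norm x ^ 2 := by ring

lemma contDiff_gradient {n : ℕ} {j : (Fin n → ℝ) → ℝ} (hj : ContDiff ℝ 2 j)
    {G : (Fin n → ℝ) → (Fin n → ℝ)} (hG : ∀ u v : Fin n → ℝ, fderiv ℝ j u v = G u ⬝ᵥ v) :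
    ContDiff ℝ 1 G := by
  refine contDiff_pi.2 fun p => ?_
  have h : (fun u => G u p) = fun u => fderiv ℝ j u (Pi.single p 1) := by
    ext u
    simp [hG]
  rw [h]
  exact (hj.fderiv_right (m := 1) (by norm_num)).clm_apply contDiff_const

lemma continuous_jacobian_entry {n : ℕ} {G : (Fin n → ℝ) → (Fin n → ℝ)} (hG : ContDiff ℝ 1 G)
    {H : (Fin n → ℝ) → Matrix (Fin n) (Fin n) ℝ}
    (hH : ∀ u v : Fin n → ℝ, fderiv ℝ G u v = (H u).mulVec v) (p q : Fin n) :
    Continuous fun u => H u p q := by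
  have h : (fun u => H u p q) = fun u => fderiv ℝ G u (Pi.single q 1) p := by
    ext u
    simp [hH]
  rw [h]
  exact (continuous_apply p).comp
    ((hG.continuous_fderiv one_ne_zero).clm_apply continuous_const)

/-- A quadratic form commutes with entrywise integration of its matrix. -/
lemma dotProduct_integral_mulVec {n : ℕ} {A : ℝ → Matrix (Fin n) (Fin n) ℝ}
    (hA : ∀ p q, Continuous fun t => A t p q) (a b : ℝ) (x : Fin n → ℝ) :
    x ⬝ᵥ (Matrix.of fun p q => ∫ t in a..b, A t p q) *ᵥ x = ∫ t in a..b, x ⬝ᵥ A t *ᵥ x := by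
  simp only [dotProduct, mulVec, of_apply]
  rw [integral_finsetSum fun p _ => Continuous.intervalIntegrable (by fun_prop) _ _]
  refine Finset.sum_congr rfl fun p _ => ?_
  rw [integral_const_mul,
    integral_finsetSum fun q _ => Continuous.intervalIntegrable (by fun_prop) _ _]
  simp only [integral_mul_const]

/-- Second-order Taylor expansion around `v` with integral remainder. -/
lemma sub_eq_gradient_sub_integral_hessian {n : ℕ} {j : (Fin n → ℝ) → ℝ} (hj : ContDiff ℝ 2 j)
    {G : (Fin n → ℝ) → (Fin n → ℝ)} (hG : ∀ u v : Fin n → ℝ, fderiv ℝ j u v = G u ⬝ᵥ v)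
    {H : (Fin n → ℝ) → Matrix (Fin n) (Fin n) ℝ}
    (hH : ∀ u v : Fin n → ℝ, fderiv ℝ G u v = (H u).mulVec v) (v w : Fin n → ℝ) :
    j v - j w = G v ⬝ᵥ (v - w) - (v - w) ⬝ᵥ
      (Matrix.of fun p q => ∫ θ in (0:ℝ)..1, θ * H (θ • v + (1 - θ) • w) p q) *ᵥ (v - w) := by
  have hG1 := contDiff_gradient hj hG
  have hHc := continuous_jacobian_entry hG1 hH
  set γ : ℝ → Fin n → ℝ := fun θ => θ • v + (1 - θ) • w with hγ
  have hγc : Continuous γ := by fun_prop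
  have hγd (θ : ℝ) : HasDerivAt γ (v - w) θ := by
    have h := ((hasDerivAt_id θ).smul_const v).add
      (((hasDerivAt_id θ).const_sub 1).smul_const w)
    rw [one_smul, neg_one_smul, ← sub_eq_add_neg] at h
    exact h
  have hφ (θ : ℝ) : HasDerivAt (fun θ => j (γ θ)) (G (γ θ) ⬝ᵥ (v - w)) θ := by
    rw [← hG]
    exact ((hj.differentiable two_ne_zero _).hasFDerivAt).comp_hasDerivAt θ (hγd θ)
  have hψ (θ : ℝ) :
      HasDerivAt (fun θ => G (γ θ) ⬝ᵥ (v - w)) ((v - w) ⬝ᵥ H (γ θ) *ᵥ (v - w)) θ := by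
    have h : HasDerivAt (fun θ => G (γ θ)) (H (γ θ) *ᵥ (v - w)) θ := by
      rw [← hH]
      exact ((hG1.differentiable one_ne_zero _).hasFDerivAt).comp_hasDerivAt θ (hγd θ)
    rw [dotProduct_comm]
    exact HasDerivAt.fun_sum fun p _ => (hasDerivAt_pi.1 h p).mul_const _
  have hψc : Continuous fun θ => G (γ θ) ⬝ᵥ (v - w) :=
    (hG1.continuous.comp hγc).dotProduct continuous_const
  have hHγc : Continuous fun θ => H (γ θ) :=
    continuous_matrix fun p q => (hHc p q).comp hγc
  have hqc : Continuous fun θ => (v - w) ⬝ᵥ H (γ θ) *ᵥ (v - w) :=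
    continuous_const.dotProduct (hHγc.matrix_mulVec continuous_const)
  have hftc := integral_eq_sub_of_hasDerivAt (fun θ _ => hφ θ)
    (hψc.intervalIntegrable (μ := MeasureTheory.volume) 0 1)
  have hparts := integral_mul_deriv_eq_deriv_mul (a := 0) (b := 1)
    (fun θ _ => hasDerivAt_id θ) (fun θ _ => hψ θ)
    intervalIntegrable_const (hqc.intervalIntegrable _ _)
  have hquad := dotProduct_integral_mulVec (A := fun θ => θ • H (γ θ))
    (fun p q => continuous_id.mul ((hHc p q).comp hγc)) 0 1 (v - w)
  simp only [Matrix.smul_apply, smul_eq_mul, smul_mulVec, dotProduct_smul] at hquad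
  have hγ0 : γ 0 = w := by simp [hγ]
  have hγ1 : γ 1 = v := by simp [hγ]
  simp only [id, one_mul, zero_mul, sub_zero, hγ0, hγ1] at hftc hparts
  rw [hquad, hparts, hftc]
  ring

/-- simplified output error bound.  `K` SPD, `u* = K⁻¹ f`, `j` twice
continuously differentiable with gradient `G` and Hessian `H`, `λ*` the exact adjoint
(`K λ* = ∇j(u*)`), `u_k` arbitrary, `r(w) = K w − f`, and
`B = K⁻¹ [∫₀¹ ∇²j(θu* + (1−θ)u_k) θ dθ] K⁻¹`.  Then
`|j(u*) − j(u_k)| ≤ ‖λ*‖₂ ‖r(u_k)‖₂ + σ_max(B) ‖r(u_k)‖₂²`. -/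
theorem stmt8 {n : ℕ} (K : Matrix (Fin n) (Fin n) ℝ) (hK : K.PosDef)
    (f : Fin n → ℝ)
    (j : (Fin n → ℝ) → ℝ) (hj : ContDiff ℝ 2 j)
    (G : (Fin n → ℝ) → (Fin n → ℝ))
    (hG : ∀ u v : Fin n → ℝ, fderiv ℝ j u v = G u ⬝ᵥ v)
    (H : (Fin n → ℝ) → Matrix (Fin n) (Fin n) ℝ)
    (hH : ∀ u v : Fin n → ℝ, fderiv ℝ G u v = (H u).mulVec v)
    (ustar lamstar uk : Fin n → ℝ)
    (hustar : ustar = K⁻¹.mulVec f)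
    (hlamstar : K.mulVec lamstar = G ustar)
    (B : Matrix (Fin n) (Fin n) ℝ)
    (hB : B = K⁻¹ *
      (Matrix.of fun p q => ∫ θ in (0:ℝ)..1, θ * H (θ • ustar + (1 - θ) • uk) p q) * K⁻¹) :
    |j ustar - j uk| ≤
      l2norm lamstar * l2norm (K.mulVec uk - f)
        + sigmaMax B * l2norm (K.mulVec uk - f) ^ 2 := by
  have hdet : IsUnit K.det := (Matrix.isUnit_iff_isUnit_det K).1 hK.isUnit
  have hsymm : Kᵀ = K := by simpa using hK.isHermitian.eq
  have hf : K *ᵥ ustar = f := by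
    rw [hustar, mulVec_mulVec, mul_nonsing_inv _ hdet, one_mulVec]
  set r := K *ᵥ uk - f with hr
  have hKd : K *ᵥ (ustar - uk) = -r := by
    rw [mulVec_sub, hf, hr, neg_sub]
  have hd : ustar - uk = -(K⁻¹ *ᵥ r) := by
    rw [← mulVec_neg, ← hKd, mulVec_mulVec, nonsing_inv_mul _ hdet, one_mulVec]
  have hlin : G ustar ⬝ᵥ (ustar - uk) = -(lamstar ⬝ᵥ r) := by
    rw [← hlamstar, ← vecMul_transpose, hsymm, ← dotProduct_mulVec, hKd, dotProduct_neg]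
  have hquad (M : Matrix (Fin n) (Fin n) ℝ) :
      (ustar - uk) ⬝ᵥ M *ᵥ (ustar - uk) = r ⬝ᵥ (K⁻¹ * M * K⁻¹) *ᵥ r := by
    rw [hd, mulVec_neg, neg_dotProduct_neg, ← mulVec_mulVec, ← mulVec_mulVec,
      dotProduct_mulVec r, ← mulVec_transpose, transpose_nonsing_inv, hsymm]
  rw [sub_eq_gradient_sub_integral_hessian hj hG hH, hlin, hquad, ← hB]
  calc |-(lamstar ⬝ᵥ r) - r ⬝ᵥ B *ᵥ r| ≤ |-(lamstar ⬝ᵥ r)| + |r ⬝ᵥ B *ᵥ r| := abs_sub _ _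
    _ ≤ l2norm lamstar * l2norm r + sigmaMax B * l2norm r ^ 2 := by
      rw [abs_neg]
      exact add_le_add (abs_dotProduct_le_l2norm_mul_l2norm _ _) (abs_dotProduct_mulVec_le _ _)
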